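/- arXiv:2603.11954 — 2 statements merged into one kernel-verified Lean document; each statement's English description precedes it below -/
import Mathlib

section
/- Let n ≥ 2, t ≥ 2 and 0 ≤ w < t. Define the map σ on Σ_t(n,w) by σ(a_1a_2⋯a_n) = a_2⋯a_n h_2(a_1⋯a_n), where h_2 is the first non-zero MSR successor rule. Then σ is a well-defined permutation of Σ_t(n,w) whose cycle decomposition consists of a single cycle; equivalently, starting from any string of Σ_t(n,w) and iterating σ generates a universal cycle for Σ_t(n,w). -/
/-- A string (list over `ℕ`) is a necklace if it is lexicographically less than
or equal to each of its cyclic rotations. -/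
def IsNecklace (a : List ℕ) : Prop :=
  ∀ i : ℕ, a = a.rotate i ∨ List.Lex (· < ·) a (a.rotate i)

/-- `Σ_t(n,w)`: strings of length `n` over `{0,…,t-1}` with weight at most `w`. -/
def SigmaSet (t n w : ℕ) : Set (List ℕ) :=
  {a | a.length = n ∧ (∀ x ∈ a, x < t) ∧ a.sum ≤ w}

/-- The first non-zero MSR successor rule `h_2`.  For `α = a_1 a_2 ⋯ a_n` with
missing symbol `z = w − wt(α)`: letting `j` be the largest index in `{2,…,n}`
with `a_j ≠ 0` (or `j = 1` if none; then `p = a_2⋯a_j` is the tail `a_2⋯a_n`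
with its trailing zeros removed), let `x` be the largest symbol in `{1,…,t−1}`
such that (i) `y = z − x + a_1` lies in `{0,…,t−1}` (for naturals: `x ≤ z + a_1`
and `z + a_1 − x < t`) and (ii) the length-`(n+1)` string `0^{n−j} x y a_2⋯a_j`
is a necklace (`x = 0` recording that no such symbol exists, the paper's
`x = −1`).  Then `h_2(α) = 0` if such an `x` exists and `z = x`,
`h_2(α) = z + 1` if such an `x` exists and `z < x`, and `h_2(α) = z`
otherwise. -/
noncomputable def h2 (t w : ℕ) (a : List ℕ) : ℕ :=
  match a with
  | [] => 0
  | a1 :: tail =>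
    let z := w - (a1 :: tail).sum
    let p : List ℕ := (tail.reverse.dropWhile (· == 0)).reverse
    let P : ℕ → Prop := fun x =>
      x ≠ 0 ∧ x ≤ z + a1 ∧ z + a1 - x < t ∧
        IsNecklace
          (List.replicate (tail.length - p.length) 0 ++ x :: (z + a1 - x) :: p)
    let x := @Nat.findGreatest P (Classical.decPred P) (t - 1)
    if x = 0 then z
    else if z = x then 0
    else if z < x then z + 1
    else z

theorem isNecklace_iff {a : List ℕ} : IsNecklace a ↔ ∀ i, a ≤ a.rotate i :=
  forall_congr' fun i => (le_iff_eq_or_lt (a := a) (b := a.rotate i)).symm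

theorem IsNecklace.eq_of_isRotated {a b : List ℕ} (ha : IsNecklace a) (hb : IsNecklace b)
    (h : a ~r b) : a = b := by
  rw [isNecklace_iff] at ha hb
  obtain ⟨i, rfl⟩ := h
  obtain ⟨j, hj⟩ := (List.IsRotated.symm ⟨i, rfl⟩ : a.rotate i ~r a)
  have h := hb j
  rw [hj] at h
  exact le_antisymm (ha i) h

theorem exists_isNecklace_isRotated (c : List ℕ) : ∃ a, IsNecklace a ∧ a ~r c := by
  obtain ⟨a, ha, hmin⟩ := c.cyclicPermutations.toFinset.exists_min_image id
    ⟨c, by simp [List.mem_cyclicPermutations_iff, List.IsRotated.refl]⟩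
  simp only [List.mem_toFinset, List.mem_cyclicPermutations_iff, id] at ha hmin
  exact ⟨a, isNecklace_iff.2 fun i => hmin _ ((List.IsRotated.symm ⟨i, rfl⟩).trans ha), ha⟩

theorem lt_replicate_append {m x : ℕ} {l q : List ℕ} (hl : m < l.length)
    (h0 : ∀ k < m, l.getD k 0 = 0) (hx : l.getD m 0 < x) : l < List.replicate m 0 ++ x :: q := by
  induction m generalizing l with
  | zero =>
    cases l with
    | nil => simp at hl
    | cons b l => simp at hx; simp [List.cons_lt_cons_iff, hx]
  | succ m ih =>
    cases l with
    | nil => simp at hl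
    | cons b l =>
      have hb := h0 0 (by omega)
      simp only [List.getD_cons_zero] at hb
      rw [List.replicate_succ, List.cons_append, List.cons_lt_cons_iff]
      refine Or.inr ⟨hb, ih (by simpa using hl) (fun k hk => ?_) (by simpa using hx)⟩
      simpa using h0 (k + 1) (by omega)

theorem replicate_append_lt {m v : ℕ} {l q : List ℕ} (hl : m < l.length)
    (h : (∀ k < m, l.getD k 0 = 0) → v < l.getD m 0) : List.replicate m 0 ++ v :: q < l := by
  induction m generalizing l with
  | zero =>
    cases l with
    | nil => simp at hl
    | cons b l => simp at h; simp [List.cons_lt_cons_iff, h]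
  | succ m ih =>
    cases l with
    | nil => simp at hl
    | cons b l =>
      rw [List.replicate_succ, List.cons_append, List.cons_lt_cons_iff]
      rcases Nat.eq_zero_or_pos b with rfl | hb
      · refine Or.inr ⟨rfl, ih (by simpa using hl) fun h' => ?_⟩
        have := h fun k hk => ?_
        · simpa using this
        · cases k with
          | zero => simp
          | succ k => simpa using h' k (by omega)
      · exact Or.inl hb

theorem getD_rotate (l : List ℕ) {i k : ℕ} (hi : i < l.length) (hk : k < l.length) :
    (l.rotate i).getD k 0 = l.getD (if k + i < l.length then k + i else k + i - l.length) 0 := by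
  have : (k + i) % l.length = if k + i < l.length then k + i else k + i - l.length := by
    split_ifs with h
    · exact Nat.mod_eq_of_lt h
    · rw [Nat.mod_eq_sub_mod (by omega), Nat.mod_eq_of_lt (by omega)]
  rw [← this, List.getD_eq_getElem?_getD, List.getD_eq_getElem?_getD, List.getElem?_rotate hk]

/-- The word `0^m v (s - v) p`. -/
def spike (m s : ℕ) (p : List ℕ) (v : ℕ) : List ℕ :=
  List.replicate m 0 ++ v :: (s - v) :: p

theorem length_spike (m s : ℕ) (p : List ℕ) (v : ℕ) :
    (spike m s p v).length = m + 2 + p.length := by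
  simp [spike]; omega

theorem getD_spike (m s : ℕ) (p : List ℕ) (v j : ℕ) :
    (spike m s p v).getD j 0 = if j < m then 0 else if j = m then v else
      if j = m + 1 then s - v else p.getD (j - (m + 2)) 0 := by
  unfold spike
  split_ifs with h1 h2 h3
  · rw [List.getD_append _ _ _ _ (by simpa using h1)]; simp
  · subst h2; rw [List.getD_append_right _ _ _ _ (by simp)]; simp
  · subst h3; rw [List.getD_append_right _ _ _ _ (by simp)]; simp
  · rw [List.getD_append_right _ _ _ _ (by simp; omega)]
    obtain ⟨k, rfl⟩ : ∃ k, j = m + 2 + k := ⟨j - (m + 2), by omega⟩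
    simp [show m + 2 + k - m = k + 1 + 1 by omega]

theorem IsNecklace.spike_of_lt {m s x v : ℕ} {p : List ℕ} (hA : IsNecklace (spike m s p x))
    (hxs : x ≤ s) (hv : v < x) : IsNecklace (spike m s p v) := by
  rw [isNecklace_iff] at hA ⊢
  intro i
  rw [← List.rotate_mod]
  set L := m + 2 + p.length with hL
  have hlen : ∀ u, (spike m s p u).length = L := fun u => length_spike m s p u
  rw [hlen]
  have hi : i % L < L := Nat.mod_lt _ (by omega)
  generalize i % L = i at hi
  rcases Nat.eq_zero_or_pos i with rfl | hi0
  · simp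
  refine (replicate_append_lt (by simp [hlen]; omega) ?_).le
  by_contra! hcon
  obtain ⟨h0, hm⟩ := hcon
  have hidx : ∀ u k, k ≤ m → ((spike m s p u).rotate i).getD k 0 =
      (spike m s p u).getD (if k + i < L then k + i else k + i - L) 0 := fun u k hk => by
    rw [getD_rotate _ (by rw [hlen]; omega) (by rw [hlen]; omega), hlen]
  have hle : ∀ k ≤ m, (spike m s p v).getD (if k + i < L then k + i else k + i - L) 0 ≤ v :=
    fun k hk => by
      rw [← hidx v k hk]
      rcases hk.lt_or_eq with h | rfl
      · exact (h0 k h).trans_le (Nat.zero_le _)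
      · exact hm
  have hne : ∀ k ≤ m, (if k + i < L then k + i else k + i - L) ≠ m := by
    intro k hk heq
    have hkm : k < m := by split_ifs at heq <;> omega
    have h1 := h0 k hkm
    rw [hidx v k hk, heq, getD_spike] at h1
    have h2 := hle (k + 1) hkm
    have h3 : (if k + 1 + i < L then k + 1 + i else k + 1 + i - L) = m + 1 := by
      split_ifs at heq ⊢ <;> omega
    rw [h3, getD_spike] at h2
    simp at h1 h2
    omega
  have hcmp : ∀ k ≤ m,
      ((spike m s p x).rotate i).getD k 0 ≤ ((spike m s p v).rotate i).getD k 0 := by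
    intro k hk
    have := hne k hk
    rw [hidx x k hk, hidx v k hk, getD_spike, getD_spike]
    generalize (if k + i < L then k + i else k + i - L) = j at *
    split_ifs <;> omega
  refine absurd (hA i) (not_le.2 (lt_replicate_append (by simp [hlen]; omega) ?_ ?_))
  · intro k hk
    have := hcmp k hk.le
    rw [h0 k hk] at this
    omega
  · exact ((hcmp m le_rfl).trans hm).trans_lt hv

theorem IsNecklace.ne_append_zero {m s x : ℕ} {p : List ℕ} (hA : IsNecklace (spike m s p x))
    (hx : 0 < x) (q : List ℕ) : p ≠ q ++ [0] := by
  rintro rfl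
  rw [isNecklace_iff] at hA
  have h := hA (List.replicate m 0 ++ x :: (s - x) :: q).length
  have e : spike m s (q ++ [0]) x = (List.replicate m 0 ++ x :: (s - x) :: q) ++ [0] := by
    simp [spike]
  conv_rhs at h => rw [e]
  rw [List.rotate_append_length_eq] at h
  refine absurd h (not_le.2 (lt_replicate_append (by simp) ?_ ?_))
  · intro k hk
    cases k with
    | zero => simp
    | succ k =>
      rw [List.singleton_append, List.getD_cons_succ, List.getD_append _ _ _ _ (by simp; omega)]
      simp
  · cases m with
    | zero => simpa
    | succ k =>
      rw [List.singleton_append, List.getD_cons_succ, List.getD_append _ _ _ _ (by simp)]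
      simpa

theorem spike_rotate (m s : ℕ) (p : List ℕ) (v : ℕ) :
    (spike m s p v).rotate (m + 1) = (s - v) :: (p ++ List.replicate m 0) ++ [v] := by
  have e : spike m s p v = (List.replicate m 0 ++ [v]) ++ (s - v) :: p := by simp [spike]
  have := List.rotate_append_length_eq (List.replicate m 0 ++ [v]) ((s - v) :: p)
  simp only [List.length_append, List.length_replicate, List.length_singleton] at this
  rw [e, this]; simp

theorem spike_rotate_succ (m s : ℕ) (p : List ℕ) (v : ℕ) :
    (spike m s p v).rotate (m + 2) = p ++ List.replicate m 0 ++ [v, s - v] := by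
  rw [← List.rotate_rotate _ (m + 1) 1, spike_rotate]; simp

theorem exists_eq_append_replicate_zero (b : List ℕ) :
    ∃ (p : List ℕ) (m : ℕ), b = p ++ List.replicate m 0 ∧ ∀ q, p ≠ q ++ [0] := by
  induction b using List.reverseRecOn with
  | nil => exact ⟨[], 0, by simp⟩
  | append_singleton b z ih =>
    rcases Nat.eq_zero_or_pos z with rfl | hz
    · obtain ⟨p, m, rfl, hp⟩ := ih
      exact ⟨p, m + 1, by simp [List.replicate_succ'], hp⟩
    · refine ⟨b ++ [z], 0, by simp, fun q h => ?_⟩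
      have := (List.append_inj' h rfl).2
      simp at this; omega

/-- The number of leading zeros. -/
def leadingZeros (l : List ℕ) : ℕ := (l.takeWhile (· == 0)).length

theorem leadingZeros_replicate_append (m : ℕ) (q : List ℕ) :
    leadingZeros (List.replicate m 0 ++ q) = m + leadingZeros q := by
  induction m with
  | zero => simp
  | succ m ih =>
    simp only [leadingZeros, List.replicate_succ, List.cons_append] at ih ⊢
    simp; omega

theorem leadingZeros_spike {m s v : ℕ} {p : List ℕ} (hv : 0 < v) :
    leadingZeros (spike m s p v) = m := by
  rw [spike, leadingZeros_replicate_append]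
  simp [leadingZeros, hv.ne']

theorem lt_leadingZeros_spike_zero (m s : ℕ) (p : List ℕ) :
    m < leadingZeros (spike m s p 0) := by
  rw [spike, leadingZeros_replicate_append]
  simp [leadingZeros]

theorem sum_spike {m s v : ℕ} {p : List ℕ} (hv : v ≤ s) : (spike m s p v).sum = s + p.sum := by
  simp [spike]; omega

theorem exists_eq_spike_rotate {c : List ℕ} (hc : 2 ≤ c.length) :
    ∃ m s p z, z ≤ s ∧ c = (spike m s p z).rotate (m + 1) ∧ ∀ q, p ≠ q ++ [0] := by
  obtain ⟨a, c, rfl⟩ := List.exists_cons_of_length_pos (by omega : 0 < c.length)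
  rcases List.eq_nil_or_concat c with rfl | ⟨b, z, rfl⟩
  · simp at hc
  · obtain ⟨p, m, rfl, hp⟩ := exists_eq_append_replicate_zero b
    exact ⟨m, a + z, p, z, by omega, by rw [spike_rotate]; simp, hp⟩

/-- The cyclic shift of `{0, …, X}`, extended by the identity. -/
def cycleTo (X v : ℕ) : ℕ :=
  if X = 0 then v else if v = X then 0 else if v < X then v + 1 else v

theorem cycleTo_le {X v s : ℕ} (hX : X ≤ s) (hv : v ≤ s) : cycleTo X v ≤ s := by
  unfold cycleTo; split_ifs <;> omega

theorem cycleTo_injective (X : ℕ) : Function.Injective (cycleTo X) := by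
  intro u v h
  unfold cycleTo at h
  split_ifs at h <;> omega

/-- `r` identifies each word `(s - v) p 0^m v` with its successor, for a successor rule which
permutes the possible symbols `v` cyclically up to the last one giving a necklace. -/
def Linked (r : List ℕ → List ℕ → Prop) (m s : ℕ) (p : List ℕ) : Prop :=
  ∃ X ≤ s, (X ≠ 0 → IsNecklace (spike m s p X)) ∧
    (∀ v, 0 < v → v ≤ s → IsNecklace (spike m s p v) → v ≤ X) ∧
    ∀ v ≤ s, r ((spike m s p v).rotate (m + 1)) ((spike m s p (cycleTo X v)).rotate (m + 2))

section Linked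

variable {r : List ℕ → List ℕ → Prop} {N w : ℕ}

theorem rel_spike_zero (hr : Equivalence r) {m s X : ℕ} {p : List ℕ} (hX : X ≤ s)
    (hlink : ∀ v ≤ s,
      r ((spike m s p v).rotate (m + 1)) ((spike m s p (cycleTo X v)).rotate (m + 2)))
    (hrot : ∀ v, 0 < v → v ≤ X →
      r ((spike m s p v).rotate (m + 1)) ((spike m s p v).rotate (m + 2))) :
    ∀ v ≤ X, r ((spike m s p 0).rotate (m + 1)) ((spike m s p v).rotate (m + 1)) := by
  intro v
  induction v with
  | zero => exact fun _ => hr.refl _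
  | succ v ih =>
    intro hv
    have h := hlink v (by omega)
    rw [show cycleTo X v = v + 1 by unfold cycleTo; split_ifs <;> omega] at h
    exact hr.trans (ih (by omega)) (hr.trans h (hr.symm (hrot (v + 1) (by omega) hv)))

theorem IsNecklace.rel_rotate_succ (hr : Equivalence r) (hN : 2 ≤ N)
    (H : ∀ m s p, m + 2 + p.length = N → s + p.sum = w → (∀ q, p ≠ q ++ [0]) → Linked r m s p)
    {A : List ℕ} (hA : IsNecklace A) (hlen : A.length = N) (hsum : A.sum = w) (i : ℕ) :
    r (A.rotate i) (A.rotate (i + 1)) := by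
  induction hz : leadingZeros A using Nat.strong_induction_on generalizing A i with
  | _ l ih =>
  subst hz
  have key : ∀ i, r (A.rotate i) (A.rotate (i + 1)) ∨
      A.rotate i = A.rotate (leadingZeros A + 1) := by
    intro i
    obtain ⟨m, s, p, z, hzs, hc, hp⟩ := exists_eq_spike_rotate (c := A.rotate i) (by simp; omega)
    have hc' : A.rotate (i + 1) = (spike m s p z).rotate (m + 2) := by
      rw [← List.rotate_rotate, hc, List.rotate_rotate]
    have hAr : A.IsRotated (spike m s p z) :=
      (List.IsRotated.trans ⟨i, rfl⟩ (hc ▸ List.IsRotated.symm ⟨m + 1, rfl⟩))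
    have hl : m + 2 + p.length = N := by
      rw [← length_spike m s p z, ← hlen, hAr.perm.length_eq]
    have hs : s + p.sum = w := by
      rw [← sum_spike (m := m) hzs, ← hsum, hAr.perm.sum_eq]
    obtain ⟨X, hXs, hX, -, hlink⟩ := H m s p hl hs hp
    rw [hc, hc']
    by_cases hfix : X = 0 ∨ X < z
    · left
      have h := hlink z hzs
      rwa [show cycleTo X z = z by unfold cycleTo; split_ifs <;> omega] at h
    have hnX := hX (by omega)
    have hnz : IsNecklace (spike m s p z) := by
      rcases (show z ≤ X by omega).lt_or_eq with h | rfl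
      · exact hnX.spike_of_lt hXs h
      · exact hnX
    obtain rfl := hA.eq_of_isRotated hnz hAr
    rcases Nat.eq_zero_or_pos z with rfl | hz
    · left
      have hrot : ∀ v, 0 < v → v ≤ X →
          r ((spike m s p v).rotate (m + 1)) ((spike m s p v).rotate (m + 2)) := by
        intro v hv hvX
        refine ih _ ?_ ?_ ?_ ?_ (m + 1) rfl
        · rw [leadingZeros_spike hv]
          exact lt_leadingZeros_spike_zero m s p
        · rcases hvX.lt_or_eq with h | rfl
          · exact hnX.spike_of_lt hXs h
          · exact hnX
        · rw [length_spike, hl]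
        · rw [sum_spike (hvX.trans hXs), hs]
      have h := hlink X hXs
      rw [show cycleTo X X = 0 by unfold cycleTo; split_ifs <;> omega] at h
      exact hr.trans (rel_spike_zero hr hXs hlink hrot X le_rfl) h
    · right
      rw [leadingZeros_spike hz]
  rcases key i with h | h
  · exact h
  have hround : ∀ j, r (A.rotate (i + 1)) (A.rotate (i + (j + 1))) ∨
      r (A.rotate (i + 1)) (A.rotate i) := by
    intro j
    induction j with
    | zero => exact Or.inl (hr.refl _)
    | succ j ih =>
      rcases ih with ih | ih
      · rcases key (i + (j + 1)) with h' | h'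
        · exact Or.inl (hr.trans ih h')
        · rw [h'.trans h.symm] at ih
          exact Or.inr ih
      · exact Or.inr ih
  have hfull : A.rotate (i + (N - 1 + 1)) = A.rotate i := by
    rw [Nat.sub_add_cancel (by omega), ← List.rotate_rotate, ← hlen,
      ← List.length_rotate A i, List.rotate_length]
  rcases hround (N - 1) with h' | h'
  · rw [hfull] at h'
    exact hr.symm h'
  · exact hr.symm h'

theorem rel_of_isRotated (hr : Equivalence r) (hN : 2 ≤ N)
    (H : ∀ m s p, m + 2 + p.length = N → s + p.sum = w → (∀ q, p ≠ q ++ [0]) → Linked r m s p)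
    {A c : List ℕ} (hA : IsNecklace A) (hlen : A.length = N) (hsum : A.sum = w)
    (hc : A.IsRotated c) : r A c := by
  obtain ⟨i, rfl⟩ := hc
  induction i with
  | zero => simpa using hr.refl A
  | succ i ih => exact hr.trans ih (hA.rel_rotate_succ hr hN H hlen hsum i)

theorem exists_eq_replicate_append (A : List ℕ) :
    (∃ m, A = List.replicate m 0) ∨ ∃ m x q, 0 < x ∧ A = List.replicate m 0 ++ x :: q := by
  induction A with
  | nil => exact Or.inl ⟨0, rfl⟩
  | cons a A ih =>
    rcases Nat.eq_zero_or_pos a with rfl | ha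
    · rcases ih with ⟨m, rfl⟩ | ⟨m, x, q, hx, rfl⟩
      · exact Or.inl ⟨m + 1, rfl⟩
      · exact Or.inr ⟨m + 1, x, q, hx, rfl⟩
    · exact Or.inr ⟨0, a, A, ha, rfl⟩

theorem IsNecklace.rel_root (hr : Equivalence r) (hN : 2 ≤ N)
    (H : ∀ m s p, m + 2 + p.length = N → s + p.sum = w → (∀ q, p ≠ q ++ [0]) → Linked r m s p)
    {A : List ℕ} (hA : IsNecklace A) (hlen : A.length = N) (hsum : A.sum = w) :
    r A (List.replicate (N - 1) 0 ++ [w]) := by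
  induction hk : N - leadingZeros A using Nat.strong_induction_on generalizing A with
  | _ k ih =>
  subst hk
  obtain ⟨m, rfl⟩ | ⟨m, x, _ | ⟨y, p⟩, hx, rfl⟩ := exists_eq_replicate_append A
  · simp only [List.length_replicate, List.sum_replicate, smul_zero] at hlen hsum
    subst hlen hsum
    rw [← List.replicate_succ', Nat.sub_add_cancel (by omega)]
    exact hr.refl _
  · simp at hlen hsum
    subst hlen hsum
    exact hr.refl _
  · have e : List.replicate m 0 ++ x :: y :: p = spike m (x + y) p x := by simp [spike]
    rw [e] at hA hlen hsum ih ⊢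
    have hl := hlen
    have hs := hsum
    rw [length_spike] at hl
    rw [sum_spike (by omega)] at hs
    obtain ⟨X, hXs, hX, hmax, hlink⟩ := H m (x + y) p hl hs (hA.ne_append_zero hx)
    have hxX := hmax x hx (by omega) hA
    have hneck : ∀ v ≤ X, IsNecklace (spike m (x + y) p v) := by
      intro v hv
      rcases hv.lt_or_eq with h | rfl
      · exact (hX (by omega)).spike_of_lt hXs h
      · exact hX (by omega)
    have hlen' : ∀ v, (spike m (x + y) p v).length = N := fun v => by rw [length_spike, hl]
    have hsum' : ∀ v ≤ X, (spike m (x + y) p v).sum = w := fun v hv => by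
      rw [sum_spike (hv.trans hXs), hs]
    have h0 := rel_spike_zero hr hXs hlink (fun v _ hv =>
      (hneck v hv).rel_rotate_succ hr hN H (hlen' v) (hsum' v hv) (m + 1)) x hxX
    have hrot : ∀ v ≤ X, r (spike m (x + y) p v) ((spike m (x + y) p v).rotate (m + 1)) :=
      fun v hv => rel_of_isRotated hr hN H (hneck v hv) (hlen' v) (hsum' v hv) ⟨_, rfl⟩
    refine hr.trans (hr.trans (hrot x hxX) (hr.symm (hr.trans (hrot 0 (Nat.zero_le _)) h0))) ?_
    refine ih _ ?_ (hneck 0 (Nat.zero_le _)) (hlen' 0) (hsum' 0 (Nat.zero_le _)) rfl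
    have := lt_leadingZeros_spike_zero m (x + y) p
    rw [leadingZeros_spike hx]
    omega

theorem rel_of_length_of_sum (hr : Equivalence r) (hN : 2 ≤ N)
    (H : ∀ m s p, m + 2 + p.length = N → s + p.sum = w → (∀ q, p ≠ q ++ [0]) → Linked r m s p)
    {c d : List ℕ} (hc : c.length = N) (hcw : c.sum = w) (hd : d.length = N) (hdw : d.sum = w) :
    r c d := by
  have key : ∀ c : List ℕ, c.length = N → c.sum = w → r c (List.replicate (N - 1) 0 ++ [w]) := by
    intro c hc hcw
    obtain ⟨A, hA, hAc⟩ := exists_isNecklace_isRotated c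
    have hlen := hAc.perm.length_eq.trans hc
    have hsum := hAc.perm.sum_eq.trans hcw
    exact hr.trans (hr.symm (rel_of_isRotated hr hN H hA hlen hsum hAc))
      (hA.rel_root hr hN H hlen hsum)
  exact hr.trans (key c hc hcw) (hr.symm (key d hd hdw))

end Linked

/-- The largest symbol `x` for which `0^m x (s - x) p` is a necklace, where `p 0^m = b`, with
value `0` if there is none. -/
noncomputable def maxSymbol (t s : ℕ) (b : List ℕ) : ℕ :=
  let p := (b.reverse.dropWhile (· == 0)).reverse
  @Nat.findGreatest (fun x => x ≠ 0 ∧ x ≤ s ∧ s - x < t ∧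
    IsNecklace (spike (b.length - p.length) s p x)) (Classical.decPred _) (t - 1)

theorem h2_cons {t w a : ℕ} {b : List ℕ} (h : a + b.sum ≤ w) :
    h2 t w (a :: b) = cycleTo (maxSymbol t (w - b.sum) b) (w - (a + b.sum)) := by
  have e : w - b.sum = w - (a + b.sum) + a := by omega
  rw [e, ← List.sum_cons]
  rfl

theorem maxSymbol_le (t s : ℕ) (b : List ℕ) : maxSymbol t s b ≤ s := by
  by_cases h : maxSymbol t s b = 0
  · omega
  · exact (@Nat.findGreatest_of_ne_zero _ _ (Classical.decPred _) _ rfl h).2.1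

theorem maxSymbol_append {t s m : ℕ} {p : List ℕ} (hs : s < t) (hp : ∀ q, p ≠ q ++ [0]) :
    (maxSymbol t s (p ++ List.replicate m 0) ≠ 0 →
      IsNecklace (spike m s p (maxSymbol t s (p ++ List.replicate m 0)))) ∧
    ∀ v, 0 < v → v ≤ s → IsNecklace (spike m s p v) →
      v ≤ maxSymbol t s (p ++ List.replicate m 0) := by
  have e : ((p ++ List.replicate m 0).reverse.dropWhile (· == 0)).reverse = p := by
    rcases List.eq_nil_or_concat p with rfl | ⟨q, z, rfl⟩
    · simp
    · have hz : z ≠ 0 := fun h => hp q (by simp [h])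
      simp [hz]
  have hspike : ∀ x, spike ((p ++ List.replicate m 0).length -
      ((p ++ List.replicate m 0).reverse.dropWhile (· == 0)).reverse.length) s
      ((p ++ List.replicate m 0).reverse.dropWhile (· == 0)).reverse x = spike m s p x := by
    intro x
    rw [e, List.length_append, List.length_replicate, Nat.add_sub_cancel_left]
  constructor
  · intro h
    rw [← hspike]
    exact (@Nat.findGreatest_of_ne_zero _ _ (Classical.decPred _) _ rfl h).2.2.2
  · intro v hv hvs hn
    rw [← hspike] at hn
    exact @Nat.le_findGreatest _ _ (Classical.decPred _) _ (by omega) ⟨hv.ne', hvs, by omega, hn⟩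

theorem finite_SigmaSet (t n w : ℕ) : (SigmaSet t n w).Finite := by
  refine ((List.finite_length_eq (Fin t) n).image (List.map Fin.val)).subset ?_
  rintro a ⟨h1, h2, -⟩
  refine ⟨a.pmap Fin.mk h2, by simpa using h1, ?_⟩
  rw [List.map_pmap]
  simp

theorem cons_mem_SigmaSet {t n w a : ℕ} {b : List ℕ} (hw : w < t) :
    a :: b ∈ SigmaSet t (n + 1) w ↔ b.length = n ∧ a + b.sum ≤ w := by
  refine ⟨fun h => ⟨by simpa using h.1, by simpa using h.2.2⟩, fun h => ⟨by simp [h.1], ?_, ?_⟩⟩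
  · intro x hx
    have := List.le_sum_of_mem hx
    rw [List.sum_cons] at this
    omega
  · simpa using h.2

theorem append_mem_SigmaSet {t n w a : ℕ} {b : List ℕ} (hw : w < t) :
    b ++ [a] ∈ SigmaSet t (n + 1) w ↔ b.length = n ∧ a + b.sum ≤ w := by
  rw [← cons_mem_SigmaSet hw]
  simp [SigmaSet, or_imp, forall_and, and_comm, add_comm]

theorem bijOn_successor {t n w : ℕ} (hw : w < t) :
    Set.BijOn (fun a : List ℕ => a.tail ++ [h2 t w a])
      (SigmaSet t (n + 1) w) (SigmaSet t (n + 1) w) := by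
  refine (Set.Finite.injOn_iff_bijOn_of_mapsTo (finite_SigmaSet _ _ _) ?_).1 ?_
  · rintro (_ | ⟨a, b⟩) h
    · simp [SigmaSet] at h
    · rw [cons_mem_SigmaSet hw] at h
      have := cycleTo_le (maxSymbol_le t (w - b.sum) b) (by omega : w - (a + b.sum) ≤ w - b.sum)
      simp only [List.tail_cons, h2_cons h.2]
      rw [append_mem_SigmaSet hw]
      exact ⟨h.1, by omega⟩
  · rintro (_ | ⟨a, b⟩) h (_ | ⟨a', b'⟩) h' heq
    · rfl
    · simp [SigmaSet] at h
    · simp [SigmaSet] at h'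
    · rw [cons_mem_SigmaSet hw] at h h'
      simp only [List.tail_cons, h2_cons h.2, h2_cons h'.2] at heq
      obtain ⟨rfl, h3⟩ := List.append_inj' heq rfl
      have := cycleTo_injective _ (List.singleton_injective h3)
      rw [show a = a' by omega]

theorem equivalence_exists_iterate_eq {α β : Type*} (f : α → α) (g : β → α) :
    Equivalence fun c d => ∃ i j : ℕ, f^[i] (g c) = f^[j] (g d) where
  refl _ := ⟨0, 0, rfl⟩
  symm := fun ⟨i, j, h⟩ => ⟨j, i, h.symm⟩
  trans := by
    rintro a b c ⟨i, j, h⟩ ⟨k, l, h'⟩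
    refine ⟨k + i, j + l, ?_⟩
    rw [Function.iterate_add_apply, h, ← Function.iterate_add_apply, Nat.add_comm k j,
      Function.iterate_add_apply, h', ← Function.iterate_add_apply]

theorem exists_iterate_eq_of_iterate_eq {α : Type*} {f : α → α} {S : Set α} (hS : S.Finite)
    (hf : Set.BijOn f S S) {a b : α} (hb : b ∈ S) {i j : ℕ} (h : f^[i] a = f^[j] b) :
    ∃ m : ℕ, f^[m] a = b := by
  have := hS.to_subtype
  have hinj : Function.Injective (hf.mapsTo.restrict f S S) :=
    (Set.MapsTo.restrict_inj hf.mapsTo).2 hf.injOn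
  obtain ⟨k, hk, hper⟩ := Function.mem_periodicPts.1 (hinj.mem_periodicPts ⟨b, hb⟩)
  have hper' : Function.IsPeriodicPt f k b := by
    have := congrArg Subtype.val hper
    rwa [Set.MapsTo.iterate_restrict] at this
  refine ⟨k * j - j + i, ?_⟩
  rw [Function.iterate_add_apply, h, ← Function.iterate_add_apply,
    Nat.sub_add_cancel (Nat.le_mul_of_pos_left j hk)]
  exact hper'.mul_const j

/-- Let `n ≥ 2`, `t ≥ 2` and `0 ≤ w < t`, and define
`σ(a_1⋯a_n) = a_2⋯a_n h_2(a_1⋯a_n)`.  Then `σ` is a well-defined permutation of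
`Σ_t(n,w)` whose cycle decomposition consists of a single cycle; equivalently,
starting from any string of `Σ_t(n,w)` and iterating `σ` generates a universal
cycle for `Σ_t(n,w)`. -/
theorem stmt9 (t n w : ℕ) (ht : 2 ≤ t) (hn : 2 ≤ n) (hw : w < t) :
    Set.BijOn (fun a : List ℕ => a.tail ++ [h2 t w a])
      (SigmaSet t n w) (SigmaSet t n w) ∧
    (∀ a ∈ SigmaSet t n w, ∀ b ∈ SigmaSet t n w,
      ∃ m : ℕ, (fun a : List ℕ => a.tail ++ [h2 t w a])^[m] a = b) := by
  obtain ⟨n, rfl⟩ : ∃ k, n = k + 1 := ⟨n - 1, by omega⟩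
  refine ⟨bijOn_successor hw, fun a ha b hb => ?_⟩
  set f := fun a : List ℕ => a.tail ++ [h2 t w a] with hf
  have hlinked : ∀ m s p, m + 2 + p.length = n + 2 → s + p.sum = w → (∀ q, p ≠ q ++ [0]) →
      Linked (fun c d => ∃ i j : ℕ, f^[i] c.dropLast = f^[j] d.dropLast) m s p := by
    intro m s p hl hs hp
    obtain rfl : s = w - p.sum := by omega
    have hsum : (p ++ List.replicate m 0).sum = p.sum := by simp
    have hmax := maxSymbol_append (m := m) (by omega : w - p.sum < t) hp
    refine ⟨_, maxSymbol_le _ _ _, hmax.1, hmax.2, fun v hv => ⟨1, 0, ?_⟩⟩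
    rw [spike_rotate, spike_rotate_succ, List.dropLast_concat]
    have hv' : w - p.sum - v + (p ++ List.replicate m 0).sum ≤ w := by omega
    simp only [Function.iterate_one, hf, List.tail_cons, h2_cons hv', Function.iterate_zero, id]
    rw [hsum, show w - (w - p.sum - v + p.sum) = v by omega]
    simp
  have hext : ∀ c ∈ SigmaSet t (n + 1) w,
      (c ++ [w - c.sum]).length = n + 2 ∧ (c ++ [w - c.sum]).sum = w := by
    rintro c ⟨h1, -, h3⟩
    simp [h1]
    omega
  obtain ⟨i, j, h⟩ := rel_of_length_of_sum (equivalence_exists_iterate_eq f List.dropLast)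
    (by omega) hlinked (hext a ha).1 (hext a ha).2 (hext b hb).1 (hext b hb).2
  rw [List.dropLast_concat, List.dropLast_concat] at h
  exact exists_iterate_eq_of_iterate_eq (finite_SigmaSet _ _ _) (bijOn_successor hw) hb h
end

section
/- For all n ≥ 2 and k ≥ 2, there exists a cyclic sequence u_1u_2⋯u_m of length m = C(n+k−1, k) over the alphabet {0,1,…,n−1} (indices taken modulo m) such that the map sending each position i to the multiset of the k partial-sum values { 1 + u_i + u_{i+1} + ⋯ + u_{i+j−1} : 1 ≤ j ≤ k } (taken with multiplicity) is a bijection from the m positions onto the collection of all multisets of size k over {1,2,…,n}; that is, a universal cycle for the k-multisets of [n] under difference representatives exists. -/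
/-- The cyclic window of length `n` of `u` starting at position `i` (0-based). -/
def cycWindow (u : List ℕ) (n i : ℕ) : List ℕ :=
  (List.range n).map fun j => u.getD ((i + j) % u.length) 0

/-- Decoding a difference representative `d = d_1⋯d_k`: the multiset of the `k`
partial-sum values `1+d_1, 1+d_1+d_2, …, 1+d_1+⋯+d_k` (with multiplicity). -/
def diffToMultiset (k : ℕ) (d : List ℕ) : Multiset ℕ :=
  (Multiset.range k).map fun j => 1 + (d.take (j + 1)).sum

/-- If `f x` starts where `x` ends for every edge `x`, and every edge is reachable from `e₀`, then
some permutation with the same property has a single orbit. -/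
theorem exists_perm_orbit_eq_univ {E V : Type*} [Finite E] (src tgt : E → V) (e₀ : E)
    (f₀ : Equiv.Perm E) (hf₀ : ∀ e, tgt e = src (f₀ e))
    (hreach : ∀ e, Relation.ReflTransGen (fun a b => tgt a = src b) e₀ e) :
    ∃ f : Equiv.Perm E, (∀ e, tgt e = src (f e)) ∧ ∀ e, ∃ i : ℕ, f^[i] e₀ = e := by
  classical
  have hfin : {f : Equiv.Perm E | ∀ e, tgt e = src (f e)}.Finite := Set.toFinite _
  obtain ⟨f, hf, hmax⟩ := Set.exists_max_image _
    (fun f : Equiv.Perm E => {e | f.SameCycle e₀ e}.ncard) hfin ⟨f₀, hf₀⟩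
  refine ⟨f, hf, ?_⟩
  suffices h : ∀ e, f.SameCycle e₀ e by
    intro e
    obtain ⟨i, -, hi⟩ := (h e).exists_pow_eq'
    exact ⟨i, by rw [← hi, Equiv.Perm.iterate_eq_pow]⟩
  have hclosed : ∀ w w', f.SameCycle e₀ w → tgt w = tgt w' → f.SameCycle e₀ w' := by
    intro w w' hw hww'
    by_contra hw'
    let g : Equiv.Perm E := f * Equiv.swap w w'
    have hgw : g w = f w' := by simp [g]
    have hgw' : g w' = f w := by simp [g]
    have hgx : ∀ x, x ≠ w → x ≠ w' → g x = f x := fun x h1 h2 => by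
      simp [g, Equiv.swap_apply_of_ne_of_ne h1 h2]
    have hg : ∀ e, tgt e = src (g e) := by
      intro e
      by_cases h1 : e = w
      · rw [h1, hgw, hww', hf]
      · by_cases h2 : e = w'
        · rw [h2, hgw', ← hww', hf]
        · rw [hgx e h1 h2, hf]
    have hstep : ∀ x, g.SameCycle w x → g.SameCycle w (g x) := fun x hx =>
      Equiv.Perm.sameCycle_apply_right.2 hx
    have hTw' : g.SameCycle w w' := by
      by_contra hcon
      have key : ∀ j : ℕ, g.SameCycle w ((f ^ (j + 1)) w') := by
        intro j
        induction j with
        | zero => simpa [hgw] using hstep w (Equiv.Perm.SameCycle.refl _ _)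
        | succ j ih =>
          have h1 : (f ^ (j + 1)) w' ≠ w := fun h =>
            hw' (hw.trans (Equiv.Perm.SameCycle.symm ⟨((j + 1 : ℕ) : ℤ), by rwa [zpow_natCast]⟩))
          have h2 : (f ^ (j + 1)) w' ≠ w' := fun h => hcon (h ▸ ih)
          have := hstep _ ih
          rwa [hgx _ h1 h2, ← Equiv.Perm.mul_apply, ← pow_succ'] at this
      have := key (orderOf f - 1)
      rw [Nat.sub_add_cancel (orderOf_pos f), pow_orderOf_eq_one] at this
      exact hcon this
    have hTf : ∀ x, g.SameCycle w x → g.SameCycle w (f x) := by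
      intro x hx
      by_cases h1 : x = w
      · rw [h1, ← hgw']
        exact hstep _ hTw'
      · by_cases h2 : x = w'
        · rw [h2, ← hgw]
          exact hstep _ (Equiv.Perm.SameCycle.refl _ _)
        · rw [← hgx x h1 h2]
          exact hstep _ hx
    have hTS : ∀ x, f.SameCycle w x → g.SameCycle w x := by
      intro x hx
      obtain ⟨i, -, rfl⟩ := hx.exists_pow_eq'
      induction i with
      | zero => exact Equiv.Perm.SameCycle.refl _ _
      | succ i ih =>
        rw [pow_succ', Equiv.Perm.mul_apply]
        exact hTf _ (ih ⟨i, by simp⟩)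
    have he₀ : g.SameCycle e₀ w := (hTS e₀ hw.symm).symm
    refine absurd (hmax g hg) (not_le.2 (Set.ncard_lt_ncard ?_ (Set.toFinite _)))
    refine Set.ssubset_iff_subset_ne.2
      ⟨fun x hx => he₀.trans (hTS x (hw.symm.trans hx)), fun h => hw' ?_⟩
    have : w' ∈ {e | g.SameCycle e₀ e} := he₀.trans hTw'
    rwa [← h] at this
  intro e
  induction hreach e with
  | refl => exact Equiv.Perm.SameCycle.refl _ _
  | @tail b c _ hbc ih =>
    have h : f.SameCycle e₀ (f⁻¹ c) := hclosed b _ ih (by rw [hbc, hf]; simp)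
    simpa using Equiv.Perm.sameCycle_apply_right.2 h

theorem bijOn_sym_multiset (n k : ℕ) :
    Set.BijOn (fun s : Sym (Fin n) k => s.1.map fun i : Fin n => (i : ℕ) + 1) Set.univ
      {m : Multiset ℕ | Multiset.card m = k ∧ ∀ x ∈ m, 1 ≤ x ∧ x ≤ n} := by
  refine ⟨fun s _ => ⟨by simp, ?_⟩, ?_, ?_⟩
  · intro x hx
    obtain ⟨i, -, rfl⟩ := Multiset.mem_map.1 hx
    have := i.2
    omega
  · intro s _ t _ h
    exact Subtype.ext (Multiset.map_injective (fun a b hab => Fin.ext (by simpa using hab)) h)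
  · rintro m ⟨hm, hmn⟩
    refine ⟨⟨m.attach.map fun x => ⟨x.1 - 1, by have := hmn x.1 x.2; omega⟩, by simpa⟩,
      Set.mem_univ _, ?_⟩
    simp only [Multiset.map_map, Function.comp_def]
    conv_rhs => rw [← Multiset.attach_map_val m]
    exact Multiset.map_congr rfl fun x _ => Nat.sub_add_cancel (hmn x.1 x.2).1

theorem finite_multisets_of_card (n k : ℕ) :
    {m : Multiset ℕ | Multiset.card m = k ∧ ∀ x ∈ m, 1 ≤ x ∧ x ≤ n}.Finite := by
  rw [← (bijOn_sym_multiset n k).image_eq]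
  exact Set.toFinite _

theorem ncard_multisets_of_card (n k : ℕ) :
    {m : Multiset ℕ | Multiset.card m = k ∧ ∀ x ∈ m, 1 ≤ x ∧ x ≤ n}.ncard =
      (n + k - 1).choose k := by
  rw [← (bijOn_sym_multiset n k).image_eq,
    (bijOn_sym_multiset n k).injOn.ncard_image, Set.ncard_univ,
    Nat.card_eq_fintype_card, Sym.card_sym_eq_choose, Fintype.card_fin]

theorem diffToMultiset_eq_coe (k : ℕ) (d : List ℕ) :
    diffToMultiset k d = ↑((List.range k).map fun j => 1 + (d.take (j + 1)).sum) := rfl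

theorem sum_take_mono (d : List ℕ) : Monotone fun j => (d.take j).sum := by
  refine monotone_nat_of_le_succ fun j => ?_
  simp only [List.take_add_one, List.sum_append]
  omega

/-- Decoding is a bijection from difference representatives to multisets. -/
theorem bijOn_diffToMultiset (n k : ℕ) (hn : 1 ≤ n) :
    Set.BijOn (diffToMultiset k) {d : List ℕ | d.length = k ∧ d.sum ≤ n - 1}
      {m : Multiset ℕ | Multiset.card m = k ∧ ∀ x ∈ m, 1 ≤ x ∧ x ≤ n} := by
  refine ⟨?_, ?_, ?_⟩
  · rintro d ⟨-, hd⟩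
    refine ⟨by simp [diffToMultiset], fun x hx => ?_⟩
    obtain ⟨j, -, rfl⟩ := Multiset.mem_map.1 hx
    have : (d.take (j + 1)).sum ≤ d.sum := (List.take_sublist _ _).sum_le_sum (by simp)
    omega
  · rintro d ⟨hd, -⟩ d' ⟨hd', -⟩ h
    have sorted : ∀ d : List ℕ,
        ((List.range k).map fun j => 1 + (d.take (j + 1)).sum).Pairwise (· ≤ ·) := by
      intro d
      refine List.pairwise_map.2 (List.pairwise_lt_range.imp fun {a b} hab => ?_)
      exact Nat.add_le_add_left (sum_take_mono d (by omega)) 1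
    rw [diffToMultiset_eq_coe, diffToMultiset_eq_coe, Multiset.coe_eq_coe] at h
    have heq := List.Perm.eq_of_pairwise' (sorted d) (sorted d') h
    have hs : ∀ j ≤ k, (d.take j).sum = (d'.take j).sum := by
      rintro (_ | j) hj
      · simp
      · have := List.map_inj_left.1 heq j (List.mem_range.2 hj)
        omega
    refine List.ext_getElem (hd.trans hd'.symm) fun j h1 h2 => ?_
    have e1 := hs j (by omega)
    have e2 := hs (j + 1) (by omega)
    rw [List.sum_take_succ _ _ h1, List.sum_take_succ _ _ h2] at e2
    omega
  · rintro m ⟨hm, hmn⟩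
    let L := m.sort (· ≤ ·)
    have hL : L.length = k := by simp [L, hm]
    have hLn : ∀ x ∈ L, 1 ≤ x ∧ x ≤ n := fun x hx => hmn x (by simpa [L] using hx)
    have hcons : (1 :: L).Pairwise (· ≤ ·) :=
      List.pairwise_cons.2 ⟨fun x hx => (hLn x hx).1, m.pairwise_sort _⟩
    let a : ℕ → ℕ := fun j => (1 :: L).getD j 0
    have ha0 : a 0 = 1 := rfl
    have ha : ∀ j < k, a j ≤ a (j + 1) := by
      intro j hj
      have := List.pairwise_iff_getElem.1 hcons j (j + 1) (by simp; omega) (by simp; omega)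
        (by omega)
      simp only [a]
      rwa [List.getD_eq_getElem, List.getD_eq_getElem]
    let d := (List.range k).map fun j => a (j + 1) - a j
    have hsum : ∀ j ≤ k, 1 + (d.take j).sum = a j := by
      intro j
      induction j with
      | zero => simp [ha0]
      | succ j ih =>
        intro hj
        rw [List.sum_take_succ _ _ (by simp [d]; omega), ← add_assoc, ih (by omega)]
        have := ha j (by omega)
        simp only [d, List.getElem_map, List.getElem_range]
        omega
    have hlast : a k ≤ n := by
      rcases Nat.eq_zero_or_pos k with h0 | h0
      · rw [h0, ha0]; exact hn
      · obtain ⟨j, rfl⟩ : ∃ j, k = j + 1 := ⟨k - 1, by omega⟩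
        simp only [a, List.getD_cons_succ]
        rw [List.getD_eq_getElem _ _ (by omega)]
        exact (hLn _ (List.getElem_mem _)).2
    have hdl : d.length = k := by simp [d]
    refine ⟨d, ⟨hdl, ?_⟩, ?_⟩
    · have := hsum k le_rfl
      rw [List.take_of_length_le hdl.le] at this
      omega
    · rw [diffToMultiset_eq_coe]
      conv_rhs => rw [← m.sort_eq (· ≤ ·)]
      congr 1
      refine List.ext_getElem (by simp [hm]) fun j h1 h2 => ?_
      have hj : j < k := by simpa using h1
      simp only [List.getElem_map, List.getElem_range]
      rw [hsum (j + 1) hj]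
      simp only [a, List.getD_cons_succ]
      rw [List.getD_eq_getElem]

theorem tail_eq_dropLast_rotate_one (l : List ℕ) : l.tail = (l.rotate 1).dropLast := by
  cases l <;> simp

/-- Words of length `k` and weight at most `N`. -/
abbrev BoundedWord (k N : ℕ) : Type := {d : List ℕ // d ∈ {d : List ℕ | d.length = k ∧ d.sum ≤ N}}

/-- The zero word. -/
def BoundedWord.zero (k N : ℕ) : BoundedWord k N := ⟨List.replicate k 0, by simp⟩

theorem BoundedWord.reachable {k N : ℕ} (e : BoundedWord k N) :
    Relation.ReflTransGen (fun a b : BoundedWord k N => a.1.tail = b.1.dropLast)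
      (BoundedWord.zero k N) e := by
  obtain ⟨l, hl, hs⟩ := e
  have hts : ∀ j, (l.take j).sum ≤ N := fun j =>
    ((List.take_sublist _ _).sum_le_sum (by simp)).trans hs
  let v : ∀ j, j ≤ k → BoundedWord k N := fun j hj =>
    ⟨List.replicate (k - j) 0 ++ l.take j, by simp [hl]; omega, by simpa using hts j⟩
  have hv : ∀ j (hj : j ≤ k), Relation.ReflTransGen
      (fun a b : BoundedWord k N => a.1.tail = b.1.dropLast) (BoundedWord.zero k N) (v j hj) := by
    intro j
    induction j with
    | zero =>
      intro hj
      have : v 0 hj = BoundedWord.zero k N := Subtype.ext (by simp [v, BoundedWord.zero])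
      rw [this]
    | succ j ih =>
      intro hj
      refine (ih (by omega)).tail ?_
      have h1 : k - j = (k - (j + 1)) + 1 := by omega
      have h2 : j < l.length := by omega
      simp only [v]
      rw [h1, List.replicate_succ, List.cons_append, List.tail_cons, List.take_add_one,
        List.getElem?_eq_getElem h2, Option.toList_some, ← List.append_assoc,
        List.dropLast_concat]
  have hk : v k le_rfl = ⟨l, hl, hs⟩ := Subtype.ext (by simp [v, ← hl])
  exact hk ▸ hv k le_rfl

/-- Words of bounded weight admit a universal cycle. -/
theorem exists_cycWindow_bijOn (k N : ℕ) (hk : 1 ≤ k)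
    (hfin : {d : List ℕ | d.length = k ∧ d.sum ≤ N}.Finite) :
    ∃ u : List ℕ, (∀ x ∈ u, x ≤ N) ∧
      Set.BijOn (cycWindow u k) {i | i < u.length} {d | d.length = k ∧ d.sum ≤ N} := by
  have : Finite (BoundedWord k N) := hfin
  let r : BoundedWord k N → BoundedWord k N := fun e =>
    ⟨e.1.rotate 1, by simpa using e.2.1, by
      rw [(List.rotate_perm e.1 1).sum_eq]; exact e.2.2⟩
  have hr : Function.Injective r := fun a b h =>
    Subtype.ext (List.rotate_injective 1 (congrArg Subtype.val h))
  obtain ⟨f, hf, hsurj⟩ := exists_perm_orbit_eq_univ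
    (fun e : BoundedWord k N => e.1.dropLast) (fun e => e.1.tail) (BoundedWord.zero k N)
    (Equiv.ofBijective r (Finite.injective_iff_bijective.1 hr))
    (fun e => tail_eq_dropLast_rotate_one e.1) BoundedWord.reachable
  generalize BoundedWord.zero k N = e₀ at hsurj
  let p := Function.minimalPeriod f e₀
  have hp : 0 < p := Function.minimalPeriod_pos_of_mem_periodicPts
    (f.injective.mem_periodicPts e₀)
  have hshift : ∀ j (e : BoundedWord k N), j < k → e.1.getD j 0 = (f^[j] e).1.getD 0 0 := by
    intro j
    induction j with
    | zero => intro e _; rfl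
    | succ j ih =>
      intro e hj
      rw [Function.iterate_succ_apply, ← ih (f e) (by omega)]
      have h := congrArg (fun l => l.getD j 0) (hf e)
      have h1 : e.1.length = k := e.2.1
      have h2 : (f e).1.length = k := (f e).2.1
      change e.1.tail.getD j 0 = (f e).1.dropLast.getD j 0 at h
      rw [List.getD_eq_getElem _ _ (by simp; omega), List.getD_eq_getElem _ _ (by simp; omega),
        List.getElem_tail, List.getElem_dropLast] at h
      rwa [List.getD_eq_getElem _ _ (by omega), List.getD_eq_getElem _ _ (by omega)]
  let u := (List.range p).map fun i => (f^[i] e₀).1.getD 0 0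
  have hu : u.length = p := by simp [u]
  have hwin : ∀ i, cycWindow u k i = (f^[i] e₀).1 := by
    intro i
    have hlen : (f^[i] e₀).1.length = k := (f^[i] e₀).2.1
    refine List.ext_getElem (by simp [cycWindow, hlen]) fun j h1 h2 => ?_
    have hj : j < k := by omega
    rw [← List.getD_eq_getElem _ 0 h2, hshift j _ hj, ← Function.iterate_add_apply]
    simp only [cycWindow, List.getElem_map, List.getElem_range, hu]
    have hlt : (i + j) % p < p := Nat.mod_lt _ hp
    rw [List.getD_eq_getElem _ _ (by omega)]
    simp only [u, List.getElem_map, List.getElem_range]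
    rw [Function.iterate_mod_minimalPeriod_eq, add_comm]
  refine ⟨u, ?_, ?_⟩
  · intro x hx
    obtain ⟨i, -, rfl⟩ := List.mem_map.1 hx
    have hlen : (f^[i] e₀).1.length = k := (f^[i] e₀).2.1
    rw [List.getD_eq_getElem _ _ (by omega)]
    exact (List.single_le_sum (by simp) _ (List.getElem_mem _)).trans (f^[i] e₀).2.2
  · rw [hu]
    refine ⟨fun i _ => by rw [hwin]; exact (f^[i] e₀).2, ?_, ?_⟩
    · intro i hi j hj h
      rw [hwin, hwin] at h
      exact Function.iterate_injOn_Iio_minimalPeriod hi hj (Subtype.ext h)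
    · intro d hd
      obtain ⟨i, hi⟩ := hsurj ⟨d, hd⟩
      refine ⟨i % p, Nat.mod_lt _ hp, ?_⟩
      rw [hwin, Function.iterate_mod_minimalPeriod_eq, hi]

/-- For all `n ≥ 2` and `k ≥ 2`, there exists a cyclic
sequence `u_1⋯u_m` of length `m = C(n+k−1, k)` over the alphabet `{0,…,n−1}`
such that the map sending each position `i` to the multiset of the `k`
partial-sum values `{ 1 + u_i + u_{i+1} + ⋯ + u_{i+j−1} : 1 ≤ j ≤ k }` (with
multiplicity) is a bijection from the `m` positions onto the multisets of size
`k` over `{1,…,n}`; that is, a universal cycle for the `k`-multisets of `[n]`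
under difference representatives exists. -/
theorem stmt17 (n k : ℕ) (hn : 2 ≤ n) (hk : 2 ≤ k) :
    ∃ u : List ℕ, u.length = Nat.choose (n + k - 1) k ∧
      (∀ x ∈ u, x ≤ n - 1) ∧
      Set.BijOn (fun i : ℕ => diffToMultiset k (cycWindow u k i))
        {i : ℕ | i < u.length}
        {m : Multiset ℕ | Multiset.card m = k ∧ ∀ x ∈ m, 1 ≤ x ∧ x ≤ n} := by
  have hdec := bijOn_diffToMultiset n k (by omega)
  have hfin : {d : List ℕ | d.length = k ∧ d.sum ≤ n - 1}.Finite :=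
    hdec.finite_iff_finite.2 (finite_multisets_of_card n k)
  obtain ⟨u, hu, hbij⟩ := exists_cycWindow_bijOn k (n - 1) (by omega) hfin
  have h := hdec.comp hbij
  refine ⟨u, ?_, hu, h⟩
  rw [← ncard_multisets_of_card, ← h.image_eq, h.injOn.ncard_image]
  change _ = (Set.Iio u.length).ncard
  simp
end
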